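/- Let A = [A_{ij}]_{i,j=1}^n be a random n×n matrix whose entries are independent standard normal random variables, n ≥ 2. Then there exists a constant c = c(n) > 0 such that P(det A > x) = c · x^{(n−1)/2 − 1/n} e^{−n x^{2/n}/2} (1 + O(x^{−2/n})) as x → ∞. -/

import Mathlib

open MeasureTheory ProbabilityTheory Real Filter Asymptotics Set
open scoped Topology ENNReal

instance matrixMeasurableSpace (n : ℕ) : MeasurableSpace (Matrix (Fin n) (Fin n) ℝ) :=
  MeasurableSpace.pi

/-- The law of a random `n × n` matrix with independent `N(0,1)` entries. -/
noncomputable def gaussMatrix (n : ℕ) : Measure (Matrix (Fin n) (Fin n) ℝ) :=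
  (Measure.pi fun _ : Fin n => (Measure.pi fun _ : Fin n => gaussianReal 0 1)).map
    Matrix.of

/-- The phase function of the Laplace integral that relates consecutive matrix sizes,
normalised to have its minimum `0` at the origin. -/
noncomputable def detPhase (α u : ℝ) : ℝ :=
  (exp (2 * u) - 1 + α * (exp (-(2 * u) / α) - 1)) / 2

lemma continuous_detPhase (α : ℝ) : Continuous (detPhase α) := by
  unfold detPhase; fun_prop

lemma sq_div_le_detPhase {α : ℝ} (hα : 1 ≤ α) (u : ℝ) : u ^ 2 / α ≤ detPhase α u := by
  have hα0 : 0 < α := by linarith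
  unfold detPhase
  rcases le_total 0 u with hu | hu
  · have h1 := Real.quadratic_le_exp_of_nonneg (x := 2 * u) (by linarith)
    have h2 := mul_le_mul_of_nonneg_left (Real.add_one_le_exp (-(2 * u) / α)) hα0.le
    have h3 : α * (-(2 * u) / α + 1) = -(2 * u) + α := by field_simp
    have h4 : u ^ 2 / α ≤ u ^ 2 := div_le_self (sq_nonneg u) hα
    nlinarith
  · have h1 := Real.add_one_le_exp (2 * u)
    have h2 := mul_le_mul_of_nonneg_left (Real.quadratic_le_exp_of_nonneg
      (x := -(2 * u) / α) (div_nonneg (by linarith) hα0.le)) hα0.le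
    have h3 : α * (1 + -(2 * u) / α + (-(2 * u) / α) ^ 2 / 2) =
      α - 2 * u + 2 * (u ^ 2 / α) := by field_simp; ring
    nlinarith

lemma abs_exp_sub_cubic_le (x : ℝ) :
    |exp x - (1 + x + x ^ 2 / 2 + x ^ 3 / 6)| ≤ x ^ 4 * exp |x| := by
  have h := Complex.norm_exp_sub_sum_le_norm_mul_exp (x : ℂ) 4
  have h2 : Complex.exp x - ∑ m ∈ Finset.range 4, (x : ℂ) ^ m / (m.factorial : ℂ) =
      ((exp x - (1 + x + x ^ 2 / 2 + x ^ 3 / 6) : ℝ) : ℂ) := by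
    simp [Finset.sum_range_succ, Nat.factorial]
  rw [h2, Complex.norm_real, Complex.norm_real, Real.norm_eq_abs, Real.norm_eq_abs] at h
  rwa [Even.pow_abs (by decide)] at h

lemma abs_detPhase_sub_cubic_le {α : ℝ} (hα : 1 ≤ α) (u : ℝ) :
    |detPhase α u - (1 + 1 / α) * u ^ 2 - 2 / 3 * (1 - 1 / α ^ 2) * u ^ 3|
      ≤ 16 * u ^ 4 * exp (2 * |u|) := by
  have hα0 : 0 < α := by linarith
  have h1 := abs_exp_sub_cubic_le (2 * u)
  have h2 := abs_exp_sub_cubic_le (-(2 * u) / α)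
  rw [abs_mul, abs_two] at h1
  have h3 : |-(2 * u) / α| ≤ 2 * |u| := by
    rw [abs_div, abs_neg, abs_mul, abs_two, abs_of_pos hα0]
    exact div_le_self (by positivity) hα
  have h4 : α * ((-(2 * u) / α) ^ 4 * exp |-(2 * u) / α|) ≤ 16 * u ^ 4 * exp (2 * |u|) := by
    have : α * (-(2 * u) / α) ^ 4 = 16 * u ^ 4 / α ^ 3 := by field_simp; ring
    rw [← mul_assoc, this]
    gcongr
    exact div_le_self (by positivity) (one_le_pow₀ hα)
  have h5 : detPhase α u - (1 + 1 / α) * u ^ 2 - 2 / 3 * (1 - 1 / α ^ 2) * u ^ 3 =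
      (exp (2 * u) - (1 + 2 * u + (2 * u) ^ 2 / 2 + (2 * u) ^ 3 / 6)) / 2 +
      α * (exp (-(2 * u) / α) - (1 + -(2 * u) / α + (-(2 * u) / α) ^ 2 / 2
        + (-(2 * u) / α) ^ 3 / 6)) / 2 := by
    unfold detPhase; field_simp; ring
  rw [h5]
  refine (abs_add_le _ _).trans ?_
  rw [abs_div, abs_div, abs_mul, abs_two, abs_of_pos hα0]
  have h6 := mul_le_mul_of_nonneg_left h2 hα0.le
  nlinarith

lemma abs_exp_sub_one_sub_le (z : ℝ) : |exp z - 1 - z| ≤ z ^ 2 * max 1 (exp z) := by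
  have h0 : 0 ≤ exp z - 1 - z := by linarith [Real.add_one_le_exp z]
  rw [abs_of_nonneg h0]
  rcases le_total |z| 1 with h | h
  · have := Real.abs_exp_sub_one_sub_id_le h
    rw [abs_of_nonneg h0] at this
    nlinarith [le_max_left 1 (exp z), sq_nonneg z]
  · rcases le_abs'.1 h with h | h
    · have : exp z ≤ 1 := Real.exp_le_one_iff.2 (by linarith)
      nlinarith [le_max_left 1 (exp z), sq_nonneg z]
    · have h1 : z ^ 2 * exp z ≤ z ^ 2 * max 1 (exp z) := by gcongr; exact le_max_right _ _
      have h2 : exp z ≤ z ^ 2 * exp z :=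
        le_mul_of_one_le_left (exp_pos z).le (one_le_pow₀ h)
      linarith

lemma integrable_exp_abs_sub_sq (B : ℝ) {c : ℝ} (hc : 0 < c) :
    Integrable fun t : ℝ => exp (B * |t| - c * t ^ 2) := by
  refine ((integrable_exp_neg_mul_sq (half_pos hc)).const_mul (exp (B ^ 2 / (2 * c)))).mono'
    (by fun_prop) (ae_of_all _ fun t => ?_)
  rw [Real.norm_eq_abs, abs_of_pos (exp_pos _), ← exp_add]
  apply exp_le_exp.2
  have h : B ^ 2 / (2 * c) + -(c / 2) * t ^ 2 - (B * |t| - c * t ^ 2) =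
      (B - c * |t|) ^ 2 / (2 * c) := by
    field_simp; ring_nf; rw [sq_abs]
  have : 0 ≤ (B - c * |t|) ^ 2 / (2 * c) := by positivity
  linarith

lemma rescaled_detPhase_estimate {α : ℝ} (hα : 1 ≤ α) (b : ℝ) :
    ∃ M B : ℝ, ∀ ε : ℝ, 0 < ε → ε ≤ 1 → ∀ t : ℝ,
      |exp (b * (ε * t) - detPhase α (ε * t) / ε ^ 2) - exp (-(1 + 1 / α) * t ^ 2) *
        (1 + ε * (b * t - 2 / 3 * (1 - 1 / α ^ 2) * t ^ 3))| ≤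
      ε ^ 2 * (M * exp (B * |t| - 1 / α * t ^ 2)) := by
  have hα0 : 0 < α := by linarith
  set a : ℝ := 2 / 3 * (1 - 1 / α ^ 2) with ha
  set k : ℝ := 1 + 1 / α with hk
  set N : ℝ := |b| + |a| + 16 with hN
  refine ⟨N ^ 2 + 16, 12 + |b|, fun ε hε hε1 t => ?_⟩
  set E := exp |t| with hE
  have hE1 : 1 ≤ E := Real.one_le_exp (abs_nonneg t)
  have htE : |t| ≤ E := by linarith [Real.add_one_le_exp |t|]
  set z : ℝ := b * (ε * t) - detPhase α (ε * t) / ε ^ 2 + k * t ^ 2 with hz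
  have hw := abs_detPhase_sub_cubic_le hα (ε * t)
  rw [← ha, ← hk] at hw
  have hrem : |z - ε * (b * t - a * t ^ 3)| ≤ ε ^ 2 * (16 * E ^ 6) := by
    have e1 : z - ε * (b * t - a * t ^ 3) =
        -((detPhase α (ε * t) - k * (ε * t) ^ 2 - a * (ε * t) ^ 3) / ε ^ 2) := by
      rw [hz]; field_simp; ring
    rw [e1, abs_neg, abs_div, abs_of_pos (by positivity : 0 < ε ^ 2), div_le_iff₀ (by positivity)]
    refine hw.trans ?_
    have e2 : exp (2 * |ε * t|) ≤ E ^ 2 := by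
      rw [hE, ← exp_nat_mul]
      apply exp_le_exp.2
      rw [abs_mul, abs_of_pos hε]
      push_cast
      nlinarith [abs_nonneg t]
    have e3 : t ^ 4 ≤ E ^ 4 := by
      rw [← Even.pow_abs (by decide)]; gcongr
    calc 16 * (ε * t) ^ 4 * exp (2 * |ε * t|) = 16 * ε ^ 4 * (t ^ 4 * exp (2 * |ε * t|)) := by ring
      _ ≤ 16 * ε ^ 4 * (E ^ 4 * E ^ 2) := by gcongr
      _ = _ := by ring
  have hzb : |z| ≤ ε * (N * E ^ 6) := by
    have e1 : |ε * (b * t - a * t ^ 3)| ≤ ε * ((|b| + |a|) * E ^ 6) := by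
      rw [abs_mul, abs_of_pos hε]
      gcongr
      refine (abs_sub _ _).trans ?_
      rw [abs_mul, abs_mul, abs_pow]
      have f1 : |t| ≤ E ^ 6 := htE.trans (le_self_pow₀ hE1 (by norm_num))
      have f2 : |t| ^ 3 ≤ E ^ 6 :=
        (pow_le_pow_left₀ (abs_nonneg t) htE 3).trans (pow_le_pow_right₀ hE1 (by norm_num))
      nlinarith [abs_nonneg b, abs_nonneg a]
    have e2 : ε ^ 2 * (16 * E ^ 6) ≤ ε * (16 * E ^ 6) := by
      gcongr; nlinarith
    have e3 : z = (z - ε * (b * t - a * t ^ 3)) + ε * (b * t - a * t ^ 3) := by ring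
    calc |z| ≤ |z - ε * (b * t - a * t ^ 3)| + |ε * (b * t - a * t ^ 3)| := by
          conv_lhs => rw [e3]
          exact abs_add_le _ _
      _ ≤ ε * (16 * E ^ 6) + ε * ((|b| + |a|) * E ^ 6) := by linarith
      _ = _ := by rw [hN]; ring
  have hz2 : z ^ 2 ≤ ε ^ 2 * (N ^ 2 * E ^ 12) := by
    calc z ^ 2 = |z| ^ 2 := (sq_abs z).symm
      _ ≤ (ε * (N * E ^ 6)) ^ 2 := by gcongr
      _ = _ := by ring
  have hQ : exp (b * (ε * t) - detPhase α (ε * t) / ε ^ 2) = exp (-k * t ^ 2) * exp z := by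
    rw [← exp_add, hz]; ring_nf
  have hkα : 1 / α ≤ k := by rw [hk]; linarith
  have hgauss : exp (-k * t ^ 2) ≤ exp (|b| * |t| - 1 / α * t ^ 2) := by
    apply exp_le_exp.2
    nlinarith [sq_nonneg t, mul_nonneg (abs_nonneg b) (abs_nonneg t)]
  have hQle : exp (-k * t ^ 2) * exp z ≤ exp (|b| * |t| - 1 / α * t ^ 2) := by
    rw [← hQ]
    apply exp_le_exp.2
    have e1 : b * (ε * t) ≤ |b| * |t| := by
      refine (le_abs_self _).trans ?_
      rw [abs_mul, abs_mul, abs_of_pos hε]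
      gcongr
      nlinarith [abs_nonneg t]
    have e2 : 1 / α * t ^ 2 ≤ detPhase α (ε * t) / ε ^ 2 := by
      rw [le_div_iff₀ (by positivity)]
      refine le_trans (le_of_eq ?_) (sq_div_le_detPhase hα _)
      ring
    linarith
  have hmain : exp (-k * t ^ 2) * |exp z - 1 - z| ≤
      ε ^ 2 * (N ^ 2 * E ^ 12) * exp (|b| * |t| - 1 / α * t ^ 2) := by
    calc exp (-k * t ^ 2) * |exp z - 1 - z|
        ≤ exp (-k * t ^ 2) * (z ^ 2 * max 1 (exp z)) := by
          gcongr; exact abs_exp_sub_one_sub_le z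
      _ = z ^ 2 * max (exp (-k * t ^ 2)) (exp (-k * t ^ 2) * exp z) := by
          rw [mul_left_comm, mul_max_of_nonneg _ _ (exp_pos _).le, mul_one]
      _ ≤ _ := mul_le_mul hz2 (max_le hgauss hQle)
          (le_max_of_le_left (exp_pos _).le) (by positivity)
  have hsplit : exp (-k * t ^ 2) * exp z - exp (-k * t ^ 2) * (1 + ε * (b * t - a * t ^ 3)) =
      exp (-k * t ^ 2) * (exp z - 1 - z) +
      exp (-k * t ^ 2) * (z - ε * (b * t - a * t ^ 3)) := by ring
  have hE12 : exp ((12 + |b|) * |t| - 1 / α * t ^ 2) =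
      E ^ 12 * exp (|b| * |t| - 1 / α * t ^ 2) := by
    rw [hE, ← exp_nat_mul, ← exp_add]; congr 1; push_cast; ring
  rw [hQ, hsplit, hE12]
  refine (abs_add_le _ _).trans ?_
  rw [abs_mul, abs_mul, abs_of_pos (exp_pos (-k * t ^ 2))]
  have hlast : exp (-k * t ^ 2) * |z - ε * (b * t - a * t ^ 3)| ≤
      exp (|b| * |t| - 1 / α * t ^ 2) * (ε ^ 2 * (16 * E ^ 12)) := by
    refine mul_le_mul hgauss (hrem.trans ?_) (abs_nonneg _) (exp_pos _).le
    gcongr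
    · norm_num
  linarith

lemma integral_odd_mul_gaussian (k : ℝ) (f : ℝ → ℝ) (hf : ∀ t, f (-t) = -f t) :
    ∫ t : ℝ, exp (-k * t ^ 2) * f t = 0 := by
  have h := integral_neg_eq_self (fun t : ℝ => exp (-k * t ^ 2) * f t) volume
  simp only [hf, neg_sq, mul_neg, integral_neg] at h
  linarith

lemma integrable_detPhase (α : ℝ) (hα : 1 ≤ α) (b : ℝ) {l : ℝ} (hl : 1 ≤ l) :
    Integrable fun u : ℝ => exp (b * u - l * detPhase α u) := by
  have hα0 : 0 < α := by linarith
  have := continuous_detPhase α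
  refine (integrable_exp_abs_sub_sq |b| (one_div_pos.2 hα0)).mono' (by fun_prop)
    (ae_of_all _ fun u => ?_)
  rw [Real.norm_eq_abs, abs_of_pos (exp_pos _)]
  apply exp_le_exp.2
  have h1 := sq_div_le_detPhase hα u
  have h2 : b * u ≤ |b| * |u| := by rw [← abs_mul]; exact le_abs_self _
  have h3 : 0 ≤ u ^ 2 / α := by positivity
  have h4 : 1 / α * u ^ 2 = u ^ 2 / α := by ring
  nlinarith

/-- Laplace asymptotics, with relative error `O(1 / l)`, for the phase `detPhase`. -/
lemma laplace_detPhase {α : ℝ} (hα : 1 ≤ α) (b : ℝ) :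
    ∃ M : ℝ, ∀ l : ℝ, 1 ≤ l →
      |(∫ u : ℝ, exp (b * u - l * detPhase α u)) - √(π / (1 + 1 / α)) * l ^ (-(1:ℝ) / 2)|
        ≤ M * l ^ (-(3:ℝ) / 2) := by
  have hα0 : 0 < α := by linarith
  obtain ⟨M, B, hM⟩ := rescaled_detPhase_estimate hα b
  refine ⟨M * ∫ t : ℝ, exp (B * |t| - 1 / α * t ^ 2), fun l hl => ?_⟩
  have hl0 : 0 < l := by linarith
  set ε : ℝ := l ^ (-(1:ℝ) / 2) with hε
  have hε0 : 0 < ε := rpow_pos_of_pos hl0 _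
  have hε1 : ε ≤ 1 := rpow_le_one_of_one_le_of_nonpos hl (by norm_num)
  have hε2 : ε ^ 2 = l⁻¹ := by
    rw [hε, ← rpow_natCast, ← rpow_mul hl0.le]; norm_num [rpow_neg_one]
  have hε3 : l ^ (-(3:ℝ) / 2) = ε * ε ^ 2 := by
    rw [hε2, hε, ← rpow_neg_one l, ← rpow_add hl0]; norm_num
  set k : ℝ := 1 + 1 / α with hk
  have hk0 : 0 < k := by positivity
  set a : ℝ := 2 / 3 * (1 - 1 / α ^ 2) with ha
  have hscale : ∫ u : ℝ, exp (b * u - l * detPhase α u) =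
      ε * ∫ t : ℝ, exp (b * (ε * t) - detPhase α (ε * t) / ε ^ 2) := by
    have := Measure.integral_comp_mul_left (fun u : ℝ => exp (b * u - l * detPhase α u)) ε
    rw [abs_of_pos (inv_pos.2 hε0), smul_eq_mul] at this
    rw [hε2]
    simp only [div_inv_eq_mul, mul_comm _ l]
    rw [this, mul_inv_cancel_left₀ hε0.ne']
  have hint1 : Integrable fun t : ℝ => exp (b * (ε * t) - detPhase α (ε * t) / ε ^ 2) := by
    have := (integrable_detPhase α hα b hl).comp_mul_left' hε0.ne'
    rw [hε2]
    simpa only [div_inv_eq_mul, mul_comm _ l] using this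
  have hbound := integrable_exp_abs_sub_sq B (one_div_pos.2 hα0)
  have hdiff : Integrable fun t : ℝ => exp (b * (ε * t) - detPhase α (ε * t) / ε ^ 2) -
      exp (-k * t ^ 2) * (1 + ε * (b * t - a * t ^ 3)) := by
    refine ((hbound.const_mul M).const_mul (ε ^ 2)).mono' ?_ (ae_of_all _ fun t => ?_)
    · exact hint1.aestronglyMeasurable.sub (by fun_prop)
    · exact hM ε hε0 hε1 t
  have hint2 : Integrable fun t : ℝ => exp (-k * t ^ 2) * (1 + ε * (b * t - a * t ^ 3)) := by
    refine (hint1.sub hdiff).congr (ae_of_all _ fun t => ?_)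
    simp
  have hval : ∫ t : ℝ, exp (-k * t ^ 2) * (1 + ε * (b * t - a * t ^ 3)) = √(π / k) := by
    have hg := integrable_exp_neg_mul_sq hk0
    have h1 : Integrable fun t : ℝ => exp (-k * t ^ 2) * (ε * (b * t - a * t ^ 3)) := by
      refine (hint2.sub hg).congr (ae_of_all _ fun t => ?_)
      simp; ring
    simp_rw [mul_add, mul_one]
    rw [integral_add hg h1, integral_gaussian,
      integral_odd_mul_gaussian k (fun t => ε * (b * t - a * t ^ 3)) (fun t => by ring), add_zero]
  have hkey : |(∫ t : ℝ, exp (b * (ε * t) - detPhase α (ε * t) / ε ^ 2)) - √(π / k)| ≤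
      ε ^ 2 * (M * ∫ t : ℝ, exp (B * |t| - 1 / α * t ^ 2)) := by
    rw [← hval, ← integral_sub hint1 hint2, ← integral_const_mul, ← integral_const_mul,
      ← Real.norm_eq_abs]
    refine norm_integral_le_of_norm_le ((hbound.const_mul M).const_mul (ε ^ 2))
      (ae_of_all _ fun t => ?_)
    exact hM ε hε0 hε1 t
  rw [hscale, hε3, mul_comm √_ ε, ← mul_sub, abs_mul, abs_of_pos hε0]
  calc _ ≤ ε * (ε ^ 2 * (M * ∫ t : ℝ, exp (B * |t| - 1 / α * t ^ 2))) := by gcongr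
    _ = _ := by ring

/-- The law of a vector of `k` independent standard normal variables. -/
noncomputable abbrev gaussVec (k : ℕ) : Measure (Fin k → ℝ) :=
  Measure.pi fun _ : Fin k => gaussianReal 0 1

/-- The probability that the absolute determinant of a Gaussian matrix exceeds `x`. -/
noncomputable def absDetTail (n : ℕ) (x : ℝ) : ℝ :=
  (Measure.pi fun _ : Fin n => gaussVec n).real {R | x < |(Matrix.of R).det|}

lemma absDetTail_nonneg (n : ℕ) (x : ℝ) : 0 ≤ absDetTail n x := measureReal_nonneg

lemma absDetTail_le_one (n : ℕ) (x : ℝ) : absDetTail n x ≤ 1 := measureReal_le_one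

lemma antitone_absDetTail (n : ℕ) : Antitone (absDetTail n) := fun _ _ h =>
  measureReal_mono fun _ hR => lt_of_le_of_lt h hR

lemma measurable_det_of (n : ℕ) :
    Measurable fun R : Fin n → Fin n → ℝ => (Matrix.of R).det := by
  simp only [Matrix.det_apply, Matrix.of_apply]
  fun_prop

lemma gaussVec_eq_withDensity (k : ℕ) :
    gaussVec k = (volume : Measure (Fin k → ℝ)).withDensity
      fun v => ENNReal.ofReal (∏ i, gaussianPDFReal 0 1 (v i)) := by
  refine Measure.pi_eq fun s hs => ?_
  rw [withDensity_apply _ (MeasurableSet.univ_pi hs), volume_pi, Measure.restrict_pi_pi,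
    ← ofReal_integral_eq_lintegral_ofReal]
  · rw [integral_fintype_prod_eq_prod, ENNReal.ofReal_prod_of_nonneg]
    · refine Finset.prod_congr rfl fun i _ => ?_
      rw [gaussianReal_apply_eq_integral 0 one_ne_zero]
    · exact fun i _ => integral_nonneg fun x => gaussianPDFReal_nonneg 0 1 x
  · exact Integrable.fintype_prod (f := fun _ => gaussianPDFReal 0 1)
      fun i => (integrable_gaussianPDFReal 0 1).integrableOn
  · exact ae_of_all _ fun v => Finset.prod_nonneg fun i _ => gaussianPDFReal_nonneg 0 1 _

lemma prod_gaussianPDFReal (k : ℕ) (v : Fin k → ℝ) :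
    ∏ i, gaussianPDFReal 0 1 (v i) =
      (√(2 * π))⁻¹ ^ k * exp (-‖WithLp.toLp 2 v‖ ^ 2 / 2) := by
  simp [gaussianPDFReal, Finset.prod_mul_distrib, ← exp_sum, EuclideanSpace.real_norm_sq_eq,
    Finset.sum_div, neg_div]

/-- Polar coordinates for functions of the norm of a Gaussian vector. -/
lemma integral_norm_gaussVec (k : ℕ) :
    ∃ K : ℝ, 0 < K ∧ ∀ f : ℝ → ℝ,
      ∫ v, f ‖WithLp.toLp 2 v‖ ∂(gaussVec (k + 1)) =
        K * ∫ r in Ioi (0 : ℝ), r ^ k * (exp (-r ^ 2 / 2) * f r) := by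
  let E := EuclideanSpace ℝ (Fin (k + 1))
  refine ⟨(√(2 * π))⁻¹ ^ (k + 1) * ((k + 1) * (volume : Measure E).real (Metric.ball 0 1)),
    ?_, fun f => ?_⟩
  · have : 0 < (volume : Measure E).real (Metric.ball 0 1) :=
      ENNReal.toReal_pos (Metric.measure_ball_pos _ _ one_pos).ne' measure_ball_lt_top.ne
    positivity
  · have hpol := integral_fun_norm_addHaar (volume : Measure E)
      fun r => exp (-r ^ 2 / 2) * f r
    have hvol := (PiLp.volume_preserving_toLp (Fin (k + 1))).integral_comp
      (MeasurableEquiv.toLp 2 _).measurableEmbedding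
      fun x : E => exp (-‖x‖ ^ 2 / 2) * f ‖x‖
    rw [gaussVec_eq_withDensity, integral_withDensity_eq_integral_toReal_smul]
    · simp_rw [ENNReal.toReal_ofReal
        (Finset.prod_nonneg fun _ _ => gaussianPDFReal_nonneg 0 1 _), prod_gaussianPDFReal,
        smul_eq_mul, mul_assoc]
      rw [integral_const_mul, hvol, hpol]
      simp [E]
    · fun_prop
    · exact ae_of_all _ fun _ => ENNReal.ofReal_lt_top

lemma measurePreserving_toLp_gaussVec (k : ℕ) :
    MeasurePreserving (WithLp.toLp 2) (gaussVec k) (stdGaussian (EuclideanSpace ℝ (Fin k))) :=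
  ⟨by fun_prop, map_pi_eq_stdGaussian⟩

lemma measurePreserving_ofLp_gaussVec (k : ℕ) :
    MeasurePreserving WithLp.ofLp (stdGaussian (EuclideanSpace ℝ (Fin k))) (gaussVec k) :=
  (measurePreserving_toLp_gaussVec k).symm (MeasurableEquiv.toLp 2 _)

lemma measurePreserving_repr_gaussVec {k : ℕ}
    (b : OrthonormalBasis (Fin k) ℝ (EuclideanSpace ℝ (Fin k))) :
    MeasurePreserving (fun w : Fin k → ℝ => (b.repr (WithLp.toLp 2 w)).ofLp)
      (gaussVec k) (gaussVec k) :=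
  ((measurePreserving_ofLp_gaussVec k).comp
    (⟨by fun_prop, stdGaussian_map b.repr⟩ : MeasurePreserving b.repr _ _)).comp
      (measurePreserving_toLp_gaussVec k)

lemma measurePreserving_tail_gaussVec (k : ℕ) :
    MeasurePreserving (fun w : Fin (k + 1) → ℝ => fun j : Fin k => w j.succ)
      (gaussVec (k + 1)) (gaussVec k) :=
  measurePreserving_snd.comp (measurePreserving_piFinSuccAbove
    (fun _ : Fin (k + 1) => gaussianReal 0 1) 0)

lemma abs_det_of_repr {k : ℕ} (b : OrthonormalBasis (Fin k) ℝ (EuclideanSpace ℝ (Fin k)))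
    (R : Fin k → Fin k → ℝ) :
    |(Matrix.of fun i => (b.repr (WithLp.toLp 2 (R i))).ofLp).det| = |(Matrix.of R).det| := by
  let U : Matrix (Fin k) (Fin k) ℝ := Matrix.of fun i j => b i j
  have hU : U * U.transpose = 1 := by
    ext i j
    have h := orthonormal_iff_ite.1 b.orthonormal j i
    simp only [PiLp.inner_apply] at h
    simp only [Matrix.mul_apply, Matrix.transpose_apply, U, Matrix.of_apply, Matrix.one_apply]
    simpa [eq_comm] using h
  have hdet : |U.det| = 1 := by
    have h := congrArg Matrix.det hU
    rw [Matrix.det_mul, Matrix.det_transpose, Matrix.det_one] at h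
    rcases mul_self_eq_one_iff.1 h with h | h <;> simp [h]
  have hmul : (Matrix.of fun i => (b.repr (WithLp.toLp 2 (R i))).ofLp) =
      Matrix.of R * U.transpose := by
    ext i j
    simp [Matrix.mul_apply, U, OrthonormalBasis.repr_apply_apply, PiLp.inner_apply]
  rw [hmul, Matrix.det_mul, Matrix.det_transpose, abs_mul, hdet, mul_one]

lemma exists_orthonormalBasis_repr_eq {k : ℕ} (v : EuclideanSpace ℝ (Fin (k + 1))) (hv : v ≠ 0) :
    ∃ b : OrthonormalBasis (Fin (k + 1)) ℝ (EuclideanSpace ℝ (Fin (k + 1))),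
      b.repr v = EuclideanSpace.single 0 ‖v‖ := by
  have hon : Orthonormal ℝ (({0} : Set (Fin (k + 1))).domRestrict
      fun _ => (‖v‖⁻¹ • v : EuclideanSpace ℝ (Fin (k + 1)))) := by
    refine ⟨fun i => ?_, fun i j hij => (hij (Subsingleton.elim i j)).elim⟩
    simp [Set.domRestrict, norm_smul, norm_ne_zero_iff.2 hv]
  obtain ⟨b, hb⟩ := hon.exists_orthonormalBasis_extension_of_card_eq (by simp)
  have hb0 : v = ‖v‖ • b 0 := by
    rw [hb 0 rfl, smul_smul, mul_inv_cancel₀ (norm_ne_zero_iff.2 hv), one_smul]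
  refine ⟨b, ?_⟩
  conv_lhs => rw [hb0]
  rw [map_smul, b.repr_self]
  ext i
  simp

lemma measureReal_abs_det_cons (k : ℕ) (x : ℝ) (v : Fin (k + 1) → ℝ) (hv : v ≠ 0) :
    (Measure.pi fun _ : Fin k => gaussVec (k + 1)).real
      {R | x < |(Matrix.of (Fin.cons v R : Fin (k + 1) → Fin (k + 1) → ℝ)).det|} =
    absDetTail k (x / ‖WithLp.toLp 2 v‖) := by
  have hv' : WithLp.toLp 2 v ≠ 0 := by simpa using hv
  have hpos : 0 < ‖WithLp.toLp 2 v‖ := norm_pos_iff.2 hv'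
  obtain ⟨b, hb⟩ := exists_orthonormalBasis_repr_eq _ hv'
  have hmp := measurePreserving_pi (fun _ : Fin k => gaussVec (k + 1)) (fun _ => gaussVec k)
    fun _ => (measurePreserving_tail_gaussVec k).comp (measurePreserving_repr_gaussVec b)
  rw [absDetTail, ← hmp.measureReal_preimage
    (measurableSet_lt measurable_const (measurable_det_of k).abs).nullMeasurableSet]
  congr 1
  ext R
  have hdet : |(Matrix.of (Fin.cons v R : Fin (k + 1) → Fin (k + 1) → ℝ)).det| =
      ‖WithLp.toLp 2 v‖ * |(Matrix.of fun i => fun j : Fin k =>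
        (b.repr (WithLp.toLp 2 (R i))).ofLp j.succ).det| := by
    rw [← abs_det_of_repr b, Matrix.det_succ_row_zero, Fin.sum_univ_succ]
    simp only [Matrix.of_apply, Fin.cons_zero, hb]
    simp [abs_mul, Fin.succ_ne_zero]
    exact Or.inl rfl
  simp only [mem_ofPred_eq, mem_preimage, hdet, div_lt_iff₀' hpos]
  rfl

lemma absDetTail_succ_eq_integral (k : ℕ) (x : ℝ) :
    absDetTail (k + 1) x = ∫ v, absDetTail k (x / ‖WithLp.toLp 2 v‖) ∂(gaussVec (k + 1)) := by
  have hmp := (measurePreserving_piFinSuccAbove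
    (fun _ : Fin (k + 1) => gaussVec (k + 1)) 0).symm (MeasurableEquiv.piFinSuccAbove _ 0)
  have hS : MeasurableSet {R : Fin (k + 1) → Fin (k + 1) → ℝ | x < |(Matrix.of R).det|} :=
    measurableSet_lt measurable_const (measurable_det_of (k + 1)).abs
  rw [absDetTail, ← hmp.measureReal_preimage hS.nullMeasurableSet, measureReal_def,
    Measure.prod_apply (hmp.measurable hS), ← integral_toReal]
  · refine integral_congr_ae ?_
    have hne : ∀ᵐ v ∂(gaussVec (k + 1)), v ≠ 0 := by
      rw [gaussVec_eq_withDensity]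
      exact (withDensity_absolutelyContinuous _ _).ae_le (Measure.ae_ne volume 0)
    filter_upwards [hne] with v hv
    rw [← measureReal_abs_det_cons k x v hv, measureReal_def]
    congr 2
    ext R
    simp [MeasurableEquiv.piFinSuccAbove]
    rfl
  · exact (measurable_measure_prodMk_left (hmp.measurable hS)).aemeasurable
  · exact ae_of_all _ fun _ => measure_lt_top _ _

/-- The radial recursion between consecutive matrix sizes. -/
lemma exists_absDetTail_succ_eq (k : ℕ) :
    ∃ K : ℝ, 0 < K ∧ ∀ x : ℝ, absDetTail (k + 1) x =
      K * ∫ r in Ioi (0 : ℝ), r ^ k * (exp (-r ^ 2 / 2) * absDetTail k (x / r)) := by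
  obtain ⟨K, hK, h⟩ := integral_norm_gaussVec k
  exact ⟨K, hK, fun x => by rw [absDetTail_succ_eq_integral, h fun r => absDetTail k (x / r)]⟩

/-- By symmetry, the determinant of a Gaussian matrix is positive half of the time. -/
lemma pi_gaussVec_det_tail {n : ℕ} (hn : n ≠ 0) {x : ℝ} (hx : 0 ≤ x) :
    ((Measure.pi fun _ : Fin n => gaussVec n) {R | x < (Matrix.of R).det}).toReal =
      absDetTail n x / 2 := by
  obtain ⟨k, rfl⟩ := Nat.exists_eq_succ_of_ne_zero hn
  set μ := Measure.pi fun _ : Fin (k + 1) => gaussVec (k + 1) with hμ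
  have hneg : MeasurePreserving (fun w : Fin (k + 1) → ℝ => -w)
      (gaussVec (k + 1)) (gaussVec (k + 1)) := by
    have h1 : MeasurePreserving (fun y : ℝ => -y) (gaussianReal 0 1) (gaussianReal 0 1) :=
      ⟨measurable_neg, by rw [gaussianReal_map_neg, neg_zero]⟩
    exact measurePreserving_pi _ _ fun _ => h1
  have hmp : MeasurePreserving (fun R : Fin (k + 1) → Fin (k + 1) → ℝ => fun i =>
      (if i = 0 then fun w => -w else id : (Fin (k + 1) → ℝ) → Fin (k + 1) → ℝ) (R i)) μ μ := by
    refine measurePreserving_pi _ _ fun i => ?_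
    split_ifs
    · exact hneg
    · exact MeasurePreserving.id _
  have hS : MeasurableSet {R : Fin (k + 1) → Fin (k + 1) → ℝ | x < (Matrix.of R).det} :=
    measurableSet_lt measurable_const (measurable_det_of (k + 1))
  have hS' : MeasurableSet {R : Fin (k + 1) → Fin (k + 1) → ℝ | x < -(Matrix.of R).det} :=
    measurableSet_lt measurable_const (measurable_det_of (k + 1)).neg
  have hsymm : μ.real {R | x < -(Matrix.of R).det} = μ.real {R | x < (Matrix.of R).det} := by
    rw [← hmp.measureReal_preimage hS.nullMeasurableSet]
    congr 1
    ext R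
    have hdet : (Matrix.of fun i => (if i = 0 then fun w => -w else id :
        (Fin (k + 1) → ℝ) → Fin (k + 1) → ℝ) (R i)).det = -(Matrix.of R).det := by
      have : (Matrix.of fun i => (if i = 0 then fun w => -w else id :
          (Fin (k + 1) → ℝ) → Fin (k + 1) → ℝ) (R i)) =
          (Matrix.of R).updateRow 0 ((-1 : ℝ) • (Matrix.of R) 0) := by
        ext i j
        by_cases hi : i = 0
        · subst hi; simp
        · simp [hi]
      rw [this, Matrix.det_updateRow_smul, Matrix.updateRow_eq_self, neg_one_mul]
    simp only [mem_ofPred_eq, mem_preimage, hdet]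
  have hunion : {R : Fin (k + 1) → Fin (k + 1) → ℝ | x < |(Matrix.of R).det|} =
      {R | x < (Matrix.of R).det} ∪ {R | x < -(Matrix.of R).det} := by
    ext R; simp [lt_abs]
  have hdisj : Disjoint {R : Fin (k + 1) → Fin (k + 1) → ℝ | x < (Matrix.of R).det}
      {R | x < -(Matrix.of R).det} := by
    rw [Set.disjoint_left]
    intro R h1 h2
    simp only [mem_ofPred_eq] at h1 h2
    linarith
  have : absDetTail (k + 1) x = 2 * μ.real {R | x < (Matrix.of R).det} := by
    rw [absDetTail, hunion, measureReal_union hdisj hS', hsymm, two_mul]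
  rw [this, measureReal_def]
  ring

/-- The exponent of `x ^ (2 / n)` in the tail of the determinant of an `n × n` matrix. -/
noncomputable def detExponent (n : ℝ) : ℝ := n * (n - 1) / 4 - 1 / 2

/-- The tail estimate for `n × n` matrices, in the variable `μ = x ^ (2 / n)`. -/
def HasDetTail (n : ℕ) : Prop :=
  ∃ c : ℝ, 0 < c ∧ ∃ C : ℝ, ∀ μ : ℝ, 0 < μ →
    |absDetTail n (μ ^ ((n : ℝ) / 2)) - c * (μ ^ detExponent n * exp (-(n * μ) / 2))| ≤
      C * ((μ ^ (detExponent n - 1) + μ ^ (-2 : ℝ)) * exp (-(n * μ) / 2))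

lemma mills_ratio_estimate {y : ℝ} (hy : 0 < y) :
    |(∫ r in Ioi y, exp (-r ^ 2 / 2)) - exp (-y ^ 2 / 2) / y| ≤ exp (-y ^ 2 / 2) / y ^ 3 := by
  have hlim : Tendsto (fun r : ℝ => -exp (-r ^ 2 / 2)) atTop (𝓝 0) := by
    rw [← neg_zero]
    refine (tendsto_exp_atBot.comp ?_).neg
    simp only [neg_div]
    exact tendsto_neg_atTop_atBot.comp
      ((tendsto_pow_atTop two_ne_zero).atTop_div_const two_pos)
  have hderiv : ∀ r : ℝ, HasDerivAt (fun r : ℝ => exp (-r ^ 2 / 2)) (-r * exp (-r ^ 2 / 2)) r := by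
    intro r
    have h : HasDerivAt (fun r : ℝ => -r ^ 2 / 2) (-r) r := by
      refine (((hasDerivAt_pow 2 r).neg).div_const 2).congr_deriv ?_
      norm_num
      ring
    exact h.exp.congr_deriv (by ring)
  have hg : ∀ r ∈ Ioi y, HasDerivAt (fun r : ℝ => -exp (-r ^ 2 / 2))
      (r * exp (-r ^ 2 / 2)) r := fun r _ => (hderiv r).neg.congr_deriv (by ring)
  have hgint : IntegrableOn (fun r : ℝ => r * exp (-r ^ 2 / 2)) (Ioi y) :=
    integrableOn_Ioi_deriv_of_nonneg (by fun_prop) hg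
      (fun r hr => by have : 0 < r := hy.trans hr; positivity) hlim
  have hgval : ∫ r in Ioi y, r * exp (-r ^ 2 / 2) = exp (-y ^ 2 / 2) := by
    rw [integral_Ioi_of_hasDerivAt_of_tendsto (by fun_prop) hg hgint hlim]
    ring
  have hf : ∀ r ∈ Ioi y, HasDerivAt (fun r : ℝ => -exp (-r ^ 2 / 2) / r)
      (exp (-r ^ 2 / 2) * (1 + 1 / r ^ 2)) r := by
    intro r hr
    have hr0 : r ≠ 0 := (hy.trans hr).ne'
    refine ((hderiv r).neg.div (hasDerivAt_id r) hr0).congr_deriv ?_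
    simp only [id, Pi.neg_apply]
    field_simp
    ring
  have hcont : ContinuousWithinAt (fun r : ℝ => -exp (-r ^ 2 / 2) / r) (Ici y) y := by
    refine ContinuousAt.continuousWithinAt (ContinuousAt.div (by fun_prop) continuousAt_id hy.ne')
  have hflim : Tendsto (fun r : ℝ => -exp (-r ^ 2 / 2) / r) atTop (𝓝 0) :=
    hlim.div_atTop tendsto_id
  have hfint : IntegrableOn (fun r : ℝ => exp (-r ^ 2 / 2) * (1 + 1 / r ^ 2)) (Ioi y) :=
    integrableOn_Ioi_deriv_of_nonneg hcont hf (fun r _ => by positivity) hflim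
  have hfval : ∫ r in Ioi y, exp (-r ^ 2 / 2) * (1 + 1 / r ^ 2) = exp (-y ^ 2 / 2) / y := by
    rw [integral_Ioi_of_hasDerivAt_of_tendsto hcont hf hfint hflim]
    ring
  have hint : IntegrableOn (fun r : ℝ => exp (-r ^ 2 / 2)) (Ioi y) := by
    have := (integrable_exp_neg_mul_sq (half_pos one_pos)).integrableOn (s := Ioi y)
    refine this.congr_fun (fun r _ => ?_) measurableSet_Ioi
    ring_nf
  rw [← hfval, ← integral_sub hint hfint, ← Real.norm_eq_abs]
  have hbound : exp (-y ^ 2 / 2) / y ^ 3 = ∫ r in Ioi y, 1 / y ^ 3 * (r * exp (-r ^ 2 / 2)) := by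
    rw [integral_const_mul, hgval]; ring
  rw [hbound]
  refine norm_integral_le_of_norm_le (hgint.const_mul _) ?_
  refine (ae_restrict_iff' measurableSet_Ioi).2 (ae_of_all _ fun r hr => ?_)
  have hr' : y < r := hr
  have hr0 : 0 < r := hy.trans hr
  have h1 : exp (-r ^ 2 / 2) - exp (-r ^ 2 / 2) * (1 + 1 / r ^ 2) =
      -(1 / r ^ 2 * exp (-r ^ 2 / 2)) := by ring
  rw [h1, norm_neg, Real.norm_of_nonneg (by positivity), ← mul_assoc]
  gcongr
  rw [div_mul_eq_mul_div, one_mul, div_le_div_iff₀ (by positivity) (by positivity), one_mul]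
  calc y ^ 3 ≤ r ^ 3 := by gcongr
    _ = r * r ^ 2 := by ring

lemma absDetTail_zero (x : ℝ) : absDetTail 0 x = if x < 1 then 1 else 0 := by
  by_cases hx : x < 1 <;> simp [absDetTail, hx]

lemma hasDetTail_one : HasDetTail 1 := by
  obtain ⟨K, hK, h⟩ := exists_absDetTail_succ_eq 0
  refine ⟨K, hK, K, fun μ hμ => ?_⟩
  set y : ℝ := μ ^ ((1 : ℝ) / 2) with hy
  have hy0 : 0 < y := rpow_pos_of_pos hμ _
  have hy2 : y ^ 2 = μ := by
    rw [hy, ← rpow_natCast, ← rpow_mul hμ.le]; norm_num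
  have hT : absDetTail 1 y = K * ∫ r in Ioi y, exp (-r ^ 2 / 2) := by
    rw [h y]
    congr 1
    have hsub : Ioi y ⊆ Ioi (0 : ℝ) := Ioi_subset_Ioi hy0.le
    rw [← integral_indicator measurableSet_Ioi, ← integral_indicator measurableSet_Ioi]
    congr 1
    ext r
    by_cases hr : 0 < r
    · simp [indicator, hr, absDetTail_zero, div_lt_one hr]
    · have : ¬ y < r := fun hyr => hr (hy0.trans hyr)
      simp [indicator, hr, this]
  have hm := mills_ratio_estimate hy0
  rw [hy2] at hm
  have e1 : μ ^ detExponent (1 : ℕ) = 1 / y := by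
    rw [hy, one_div, ← rpow_neg hμ.le]; norm_num [detExponent]
  have e2 : μ ^ (detExponent (1 : ℕ) - 1) = 1 / y ^ 3 := by
    rw [hy, one_div, ← rpow_natCast, ← rpow_mul hμ.le, ← rpow_neg hμ.le]; norm_num [detExponent]
  have e3 : exp (-(((1 : ℕ) : ℝ) * μ) / 2) = exp (-μ / 2) := by simp
  rw [e1, e2, e3, Nat.cast_one, ← hy, hT, mul_comm (1 / y), mul_one_div, ← mul_sub, abs_mul,
    abs_of_pos hK]
  refine mul_le_mul_of_nonneg_left (hm.trans ?_) hK.le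
  have : 0 ≤ μ ^ (-2 : ℝ) * exp (-μ / 2) := by positivity
  rw [add_mul, one_div_mul_eq_div]
  linarith

/-- The radial weight after the substitution `r = √l * exp u`. -/
noncomputable def radialWeight (n : ℕ) (l u : ℝ) : ℝ :=
  √l * (exp u * ((√l * exp u) ^ n * exp (-(√l * exp u) ^ 2 / 2)))

lemma radialWeight_nonneg (n : ℕ) (l u : ℝ) : 0 ≤ radialWeight n l u := by
  unfold radialWeight; positivity

lemma integral_Ioi_eq_integral_exp (g : ℝ → ℝ) :
    ∫ r in Ioi (0 : ℝ), g r = ∫ u : ℝ, exp u * g (exp u) := by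
  have h := integral_image_eq_integral_abs_deriv_smul (s := univ) (f := exp) (f' := exp)
    MeasurableSet.univ (fun x _ => (hasDerivAt_exp x).hasDerivWithinAt) exp_injective.injOn g
  rw [image_univ, range_exp] at h
  simpa using h

lemma integral_radial_eq {n : ℕ} (hn : n ≠ 0) {l : ℝ} (hl : 0 < l) (T : ℝ → ℝ) :
    ∫ r in Ioi (0 : ℝ), r ^ n * (exp (-r ^ 2 / 2) * T (l ^ (((n + 1 : ℕ) : ℝ) / 2) / r)) =
      ∫ u : ℝ, radialWeight n l u * T ((l * exp (-(2 * u) / n)) ^ ((n : ℝ) / 2)) := by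
  have hn0 : (n : ℝ) ≠ 0 := Nat.cast_ne_zero.2 hn
  have hs : 0 < √l := sqrt_pos.2 hl
  have hsub := integral_comp_mul_left_Ioi'
    (fun r => r ^ n * (exp (-r ^ 2 / 2) * T (l ^ (((n + 1 : ℕ) : ℝ) / 2) / r))) 0 hs
  rw [mul_zero] at hsub
  rw [← hsub, integral_Ioi_eq_integral_exp, smul_eq_mul, ← integral_const_mul]
  refine integral_congr_ae (ae_of_all _ fun u => ?_)
  have harg : l ^ (((n + 1 : ℕ) : ℝ) / 2) / (√l * exp u) =
      (l * exp (-(2 * u) / n)) ^ ((n : ℝ) / 2) := by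
    rw [mul_rpow hl.le (exp_pos _).le, ← exp_mul, sqrt_eq_rpow, ← div_div, ← rpow_sub hl,
      div_eq_mul_inv, ← exp_neg]
    congr 2
    · push_cast; ring
    · field_simp
  simp only [radialWeight, harg]
  ring

lemma radialWeight_mul {n : ℕ} (hn : n ≠ 0) {l : ℝ} (hl : 0 < l) (p u : ℝ) :
    radialWeight n l u * ((l * exp (-(2 * u) / n)) ^ p *
        exp (-(n * (l * exp (-(2 * u) / n))) / 2)) =
      l ^ (((n : ℝ) + 1) / 2 + p) * exp (-((n + 1) * l) / 2) *
        exp ((n + 1 - 2 * p / n) * u - l * detPhase n u) := by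
  have hn0 : (n : ℝ) ≠ 0 := Nat.cast_ne_zero.2 hn
  have hsq : (√l * exp u) ^ 2 = l * exp (2 * u) := by
    rw [mul_pow, sq_sqrt hl.le, ← exp_nat_mul]; norm_num
  have hsqrt : √l = exp (log l / 2) := by
    rw [sqrt_eq_rpow, rpow_def_of_pos hl]; ring_nf
  rw [radialWeight, hsq, mul_rpow hl.le (exp_pos _).le, ← exp_mul, rpow_def_of_pos hl,
    rpow_def_of_pos hl, hsqrt, ← exp_add, ← exp_nat_mul]
  simp only [← exp_add]
  congr 1
  unfold detPhase
  field_simp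
  ring

lemma laplace_detPhase_le {α : ℝ} (hα : 1 ≤ α) (b : ℝ) :
    ∃ M : ℝ, ∀ l : ℝ, 1 ≤ l →
      (∫ u : ℝ, exp (b * u - l * detPhase α u)) ≤ M * l ^ (-(1:ℝ) / 2) := by
  obtain ⟨M, hM⟩ := laplace_detPhase hα b
  refine ⟨√(π / (1 + 1 / α)) + |M|, fun l hl => ?_⟩
  have h1 := (abs_le.1 (hM l hl)).2
  have h2 : M * l ^ (-(3:ℝ) / 2) ≤ |M| * l ^ (-(1:ℝ) / 2) := by
    have : l ^ (-(3:ℝ) / 2) ≤ l ^ (-(1:ℝ) / 2) := rpow_le_rpow_of_exponent_le hl (by norm_num)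
    exact mul_le_mul (le_abs_self M) this (by positivity) (abs_nonneg M)
  linarith

lemma neg_one_le_detExponent {n : ℕ} (hn : n ≠ 0) : -1 ≤ detExponent n := by
  have : (1 : ℝ) ≤ n := by exact_mod_cast Nat.one_le_iff_ne_zero.2 hn
  unfold detExponent
  nlinarith

/-- A tail estimate for `μ ≥ 1` extends to all `μ > 0`, because probabilities are at most `1`. -/
lemma HasDetTail.of_one_le {n : ℕ} (hn : n ≠ 0) {c C : ℝ} (hc : 0 < c)
    (h : ∀ μ : ℝ, 1 ≤ μ →
      |absDetTail n (μ ^ ((n : ℝ) / 2)) - c * (μ ^ detExponent n * exp (-(n * μ) / 2))| ≤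
        C * (μ ^ (detExponent n - 1) * exp (-(n * μ) / 2))) : HasDetTail n := by
  refine ⟨c, hc, |C| + exp (n / 2) + c, fun μ hμ => ?_⟩
  set e := exp (-(n * μ) / 2) with he
  have he0 : 0 < e := exp_pos _
  have hp1 : 0 < μ ^ (detExponent n - 1) := rpow_pos_of_pos hμ _
  have hp2 : 0 < μ ^ (-2 : ℝ) := rpow_pos_of_pos hμ _
  rcases le_total 1 μ with h1 | h1
  · refine (h μ h1).trans ?_
    refine mul_le_mul ?_ ?_ (by positivity) (by positivity)
    · linarith [le_abs_self C, exp_pos ((n : ℝ) / 2)]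
    · gcongr; linarith
  · have hT0 := absDetTail_nonneg n (μ ^ ((n : ℝ) / 2))
    have hT1 := absDetTail_le_one n (μ ^ ((n : ℝ) / 2))
    have hpow : μ ^ detExponent n ≤ μ ^ (-2 : ℝ) :=
      rpow_le_rpow_of_exponent_ge hμ h1 (by linarith [neg_one_le_detExponent hn])
    have hone : 1 ≤ exp (n / 2) * (μ ^ (-2 : ℝ) * e) := by
      have f1 : 1 ≤ μ ^ (-2 : ℝ) := one_le_rpow_of_pos_of_le_one_of_nonpos hμ h1 (by norm_num)
      have f2 : 1 ≤ exp (n / 2) * e := by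
        rw [he, ← exp_add]
        apply one_le_exp
        have : (n : ℝ) * μ ≤ n := mul_le_of_le_one_right (Nat.cast_nonneg n) h1
        linarith
      calc (1 : ℝ) = 1 * 1 := by norm_num
        _ ≤ μ ^ (-2 : ℝ) * (exp (n / 2) * e) := mul_le_mul f1 f2 zero_le_one hp2.le
        _ = _ := by ring
    have hmain : c * (μ ^ detExponent n * e) ≤ c * (μ ^ (-2 : ℝ) * e) := by gcongr
    have hmain0 : 0 ≤ c * (μ ^ detExponent n * e) := by positivity
    have habs : |absDetTail n (μ ^ ((n : ℝ) / 2)) - c * (μ ^ detExponent n * e)| ≤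
        1 + c * (μ ^ detExponent n * e) := abs_le.2 ⟨by linarith, by linarith⟩
    have hrest : 0 ≤ |C| * ((μ ^ (detExponent n - 1) + μ ^ (-2 : ℝ)) * e) +
        (exp (n / 2) + c) * (μ ^ (detExponent n - 1) * e) := by positivity
    linarith

lemma HasDetTail.succ {n : ℕ} (hn : n ≠ 0) (h : HasDetTail n) : HasDetTail (n + 1) := by
  obtain ⟨c, hc, C, hC⟩ := h
  obtain ⟨K, hK, hrec⟩ := exists_absDetTail_succ_eq n
  have hα : (1 : ℝ) ≤ n := by exact_mod_cast Nat.one_le_iff_ne_zero.2 hn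
  have hC0 : 0 ≤ C := by
    have h1 := (abs_nonneg _).trans (hC 1 one_pos)
    by_contra! hneg
    have : 0 < ((1 : ℝ) ^ (detExponent n - 1) + (1 : ℝ) ^ (-2 : ℝ)) * exp (-(n * (1 : ℝ)) / 2) := by
      positivity
    nlinarith
  set a := detExponent n with ha
  set B : ℝ → ℝ := fun p => n + 1 - 2 * p / n with hB
  set s := √(π / (1 + 1 / (n : ℝ))) with hs
  have hs0 : 0 < s := sqrt_pos.2 (by positivity)
  obtain ⟨M, hM⟩ := laplace_detPhase hα (B a)
  obtain ⟨M₁, hM₁⟩ := laplace_detPhase_le hα (B (a - 1))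
  obtain ⟨M₂, hM₂⟩ := laplace_detPhase_le hα (B (-2))
  have hM₂0 : 0 ≤ M₂ := by
    have h1 := (integral_nonneg fun u => (exp_pos _).le).trans (hM₂ 1 le_rfl)
    simpa using h1
  have ha' : detExponent (n + 1 : ℕ) = ((n : ℝ) + 1) / 2 + a - 1 / 2 := by
    rw [ha]; unfold detExponent; push_cast; ring
  refine HasDetTail.of_one_le (Nat.succ_ne_zero n) (c := K * (c * s))
    (C := K * (c * M + C * (M₁ + M₂))) (by positivity) fun l hl => ?_
  have hl0 : 0 < l := by linarith
  rw [hrec, integral_radial_eq hn hl0]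
  set e := exp (-((n + 1 : ℕ) * l) / 2) with he
  have he0 : 0 < e := exp_pos _
  set J : ℝ → ℝ := fun p => ∫ u : ℝ, exp (B p * u - l * detPhase n u) with hJ
  set m : ℝ → ℝ := fun u => l * exp (-(2 * u) / n) with hm
  have hm0 : ∀ u, 0 < m u := fun u => by rw [hm]; positivity
  -- the contribution of a pure power of `m`
  have hterm : ∀ p u : ℝ, radialWeight n l u * (m u ^ p * exp (-(n * m u) / 2)) =
      l ^ (((n : ℝ) + 1) / 2 + p) * e * exp (B p * u - l * detPhase n u) := by
    intro p u
    rw [hm, he, radialWeight_mul hn hl0]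
    push_cast
    rfl
  have hterm_int : ∀ p : ℝ, Integrable fun u =>
      radialWeight n l u * (m u ^ p * exp (-(n * m u) / 2)) := by
    intro p
    simp_rw [hterm p]
    exact (integrable_detPhase n hα (B p) hl).const_mul _
  have hterm_val : ∀ p : ℝ, ∫ u, radialWeight n l u * (m u ^ p * exp (-(n * m u) / 2)) =
      l ^ (((n : ℝ) + 1) / 2 + p) * e * J p := by
    intro p
    simp_rw [hterm p]
    rw [integral_const_mul]
  set main : ℝ → ℝ := fun u => c * (radialWeight n l u * (m u ^ a * exp (-(n * m u) / 2)))
    with hmain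
  set err : ℝ → ℝ := fun u => C * (radialWeight n l u * (m u ^ (a - 1) * exp (-(n * m u) / 2)) +
    radialWeight n l u * (m u ^ (-2 : ℝ) * exp (-(n * m u) / 2))) with herr
  have hmain_int : Integrable main := (hterm_int a).const_mul c
  have herr_int : Integrable err := ((hterm_int (a - 1)).add (hterm_int (-2))).const_mul C
  have hpt : ∀ u, |radialWeight n l u * absDetTail n (m u ^ ((n : ℝ) / 2)) - main u| ≤ err u := by
    intro u
    have h1 : radialWeight n l u * absDetTail n (m u ^ ((n : ℝ) / 2)) - main u =
        radialWeight n l u * (absDetTail n (m u ^ ((n : ℝ) / 2)) -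
          c * (m u ^ a * exp (-(n * m u) / 2))) := by rw [hmain]; ring
    rw [h1, abs_mul, abs_of_nonneg (radialWeight_nonneg n l u)]
    refine (mul_le_mul_of_nonneg_left (hC (m u) (hm0 u)) (radialWeight_nonneg n l u)).trans
      (le_of_eq ?_)
    rw [herr]; ring
  have hmeas : Measurable fun u => radialWeight n l u * absDetTail n (m u ^ ((n : ℝ) / 2)) := by
    have h1 := (antitone_absDetTail n).measurable
    have h2 : Measurable m := by rw [hm]; fun_prop
    unfold radialWeight
    fun_prop
  have hdiff : Integrable fun u =>
      radialWeight n l u * absDetTail n (m u ^ ((n : ℝ) / 2)) - main u :=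
    herr_int.mono' (hmeas.aestronglyMeasurable.sub hmain_int.aestronglyMeasurable)
      (ae_of_all _ hpt)
  have hint : Integrable fun u => radialWeight n l u * absDetTail n (m u ^ ((n : ℝ) / 2)) := by
    refine (hdiff.add hmain_int).congr (ae_of_all _ fun u => ?_)
    simp
  have hest : |(∫ u, radialWeight n l u * absDetTail n (m u ^ ((n : ℝ) / 2))) -
      c * (l ^ (((n : ℝ) + 1) / 2 + a) * e * J a)| ≤
      C * (l ^ (((n : ℝ) + 1) / 2 + (a - 1)) * e * J (a - 1) +
        l ^ (((n : ℝ) + 1) / 2 + (-2)) * e * J (-2)) := by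
    rw [← hterm_val, ← hterm_val, ← hterm_val, ← integral_const_mul,
      ← integral_add (hterm_int _) (hterm_int _), ← integral_const_mul,
      ← integral_sub hint hmain_int, ← Real.norm_eq_abs]
    exact norm_integral_le_of_norm_le herr_int (ae_of_all _ hpt)
  set P := l ^ (detExponent (n + 1 : ℕ) - 1) with hP
  have hP0 : 0 < P := rpow_pos_of_pos hl0 _
  have r0 : l ^ (((n : ℝ) + 1) / 2 + a) * l ^ (-(1:ℝ) / 2) = l ^ detExponent (n + 1 : ℕ) := by
    rw [← rpow_add hl0, ha']; congr 1; ring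
  have r1 : l ^ (((n : ℝ) + 1) / 2 + a) * l ^ (-(3:ℝ) / 2) = P := by
    rw [hP, ← rpow_add hl0, ha']; congr 1; ring
  have r2 : l ^ (((n : ℝ) + 1) / 2 + (a - 1)) * l ^ (-(1:ℝ) / 2) = P := by
    rw [hP, ← rpow_add hl0, ha']; congr 1; ring
  have r3 : l ^ (((n : ℝ) + 1) / 2 + (-2)) * l ^ (-(1:ℝ) / 2) ≤ P := by
    rw [hP, ← rpow_add hl0, ha']
    exact rpow_le_rpow_of_exponent_le hl (by linarith [neg_one_le_detExponent hn])
  have q1 : |c * (l ^ (((n : ℝ) + 1) / 2 + a) * e * J a) -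
      c * s * (l ^ detExponent (n + 1 : ℕ) * e)| ≤ c * M * (P * e) := by
    have h1 : c * (l ^ (((n : ℝ) + 1) / 2 + a) * e * J a) -
        c * s * (l ^ detExponent (n + 1 : ℕ) * e) =
        c * (l ^ (((n : ℝ) + 1) / 2 + a) * e) * (J a - s * l ^ (-(1:ℝ) / 2)) := by
      rw [← r0]; ring
    rw [h1, abs_mul, abs_of_nonneg (by positivity)]
    calc _ ≤ c * (l ^ (((n : ℝ) + 1) / 2 + a) * e) * (M * l ^ (-(3:ℝ) / 2)) := by
          gcongr; exact hM l hl
      _ = _ := by rw [← r1]; ring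
  have q2 : l ^ (((n : ℝ) + 1) / 2 + (a - 1)) * e * J (a - 1) ≤ M₁ * (P * e) := by
    calc _ ≤ l ^ (((n : ℝ) + 1) / 2 + (a - 1)) * e * (M₁ * l ^ (-(1:ℝ) / 2)) := by
          gcongr; exact hM₁ l hl
      _ = _ := by rw [← r2]; ring
  have q3 : l ^ (((n : ℝ) + 1) / 2 + (-2)) * e * J (-2) ≤ M₂ * (P * e) := by
    calc _ ≤ l ^ (((n : ℝ) + 1) / 2 + (-2)) * e * (M₂ * l ^ (-(1:ℝ) / 2)) := by
          gcongr; exact hM₂ l hl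
      _ = M₂ * (l ^ (((n : ℝ) + 1) / 2 + (-2)) * l ^ (-(1:ℝ) / 2) * e) := by ring
      _ ≤ _ := by gcongr
  have q4 : |(∫ u, radialWeight n l u * absDetTail n (m u ^ ((n : ℝ) / 2))) -
      c * s * (l ^ detExponent (n + 1 : ℕ) * e)| ≤ (c * M + C * (M₁ + M₂)) * (P * e) := by
    refine (abs_sub_le _ (c * (l ^ (((n : ℝ) + 1) / 2 + a) * e * J a)) _).trans ?_
    have := mul_le_mul_of_nonneg_left (add_le_add q2 q3) hC0
    linarith
  rw [mul_assoc K (c * s), ← mul_sub, abs_mul, abs_of_pos hK, mul_assoc K]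
  exact mul_le_mul_of_nonneg_left q4 hK.le

lemma hasDetTail {n : ℕ} (hn : n ≠ 0) : HasDetTail n := by
  induction n with
  | zero => exact absurd rfl hn
  | succ k ih =>
    rcases eq_or_ne k 0 with rfl | hk
    · exact hasDetTail_one
    · exact (ih hk).succ hk

lemma gaussMatrix_det_tail {n : ℕ} (hn : n ≠ 0) {x : ℝ} (hx : 0 ≤ x) :
    (gaussMatrix n {A | x < A.det}).toReal = absDetTail n x / 2 := by
  rw [← pi_gaussVec_det_tail hn hx, gaussMatrix, Measure.map_apply
    (show Measurable (Matrix.of : (Fin n → Fin n → ℝ) → _) from measurable_id)]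
  · rfl
  · exact measurableSet_lt measurable_const (measurable_det_of n)

/-- for a random `n × n` matrix `A` with i.i.d. `N(0,1)` entries, `n ≥ 2`,
there exists `c = c(n) > 0` with
`P(det A > x) = c x^{(n−1)/2 − 1/n} e^{−n x^{2/n}/2} (1 + O(x^{−2/n}))` as `x → ∞`. -/
theorem tail_det_gaussian_matrix (n : ℕ) (hn : 2 ≤ n) :
    ∃ c : ℝ, 0 < c ∧
      (fun x : ℝ =>
          (gaussMatrix n {A | x < A.det}).toReal
            - c * x ^ (((n : ℝ) - 1) / 2 - 1 / n) * Real.exp (-(n * x ^ ((2:ℝ) / n)) / 2))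
        =O[atTop]
      fun x : ℝ =>
        x ^ (((n : ℝ) - 1) / 2 - 1 / n) * Real.exp (-(n * x ^ ((2:ℝ) / n)) / 2)
          * x ^ (-(2:ℝ) / n) := by
  have hn' : n ≠ 0 := by omega
  have hn0 : (n : ℝ) ≠ 0 := Nat.cast_ne_zero.2 hn'
  obtain ⟨c, hc, C, hC⟩ := hasDetTail hn'
  refine ⟨c / 2, half_pos hc, IsBigO.of_bound |C| ?_⟩
  filter_upwards [eventually_ge_atTop 1] with x hx
  have hx0 : 0 < x := by linarith
  set μ : ℝ := x ^ ((2:ℝ) / n) with hμ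
  have hμ1 : 1 ≤ μ := one_le_rpow hx (by positivity)
  have hμ0 : 0 < μ := by linarith
  have h1 : μ ^ ((n : ℝ) / 2) = x := by
    rw [hμ, ← rpow_mul hx0.le]
    field_simp
    exact rpow_one x
  have h2 : μ ^ detExponent n = x ^ (((n : ℝ) - 1) / 2 - 1 / n) := by
    rw [hμ, ← rpow_mul hx0.le, detExponent]
    congr 1
    field_simp
    ring
  have h3 : μ ^ (detExponent n - 1) =
      x ^ (((n : ℝ) - 1) / 2 - 1 / n) * x ^ (-(2:ℝ) / n) := by
    rw [sub_eq_add_neg, rpow_add hμ0, h2, hμ, ← rpow_mul hx0.le]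
    congr 2
    ring
  have h4 : μ ^ (-2 : ℝ) ≤ μ ^ (detExponent n - 1) :=
    rpow_le_rpow_of_exponent_le hμ1 (by linarith [neg_one_le_detExponent hn'])
  have h5 := hC μ hμ0
  rw [h1, h2] at h5
  rw [gaussMatrix_det_tail hn' hx0.le, Real.norm_eq_abs, Real.norm_of_nonneg (by positivity)]
  set e := exp (-(n * μ) / 2) with he
  have h6 : absDetTail n x / 2 - c / 2 * x ^ (((n : ℝ) - 1) / 2 - 1 / n) * e =
      (absDetTail n x - c * (x ^ (((n : ℝ) - 1) / 2 - 1 / n) * e)) / 2 := by ring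
  rw [h6, abs_div, abs_two, mul_right_comm, ← h3, div_le_iff₀ two_pos]
  calc _ ≤ C * ((μ ^ (detExponent n - 1) + μ ^ (-2 : ℝ)) * e) := h5
    _ ≤ |C| * ((μ ^ (detExponent n - 1) + μ ^ (detExponent n - 1)) * e) := by
        refine mul_le_mul (le_abs_self C) ?_ (by positivity) (abs_nonneg C)
        gcongr
    _ = _ := by ring
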